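/- arXiv:2202.09787 — 2 statements merged into one kernel-verified Lean document; each statement's English description precedes it below -/
import Mathlib

section
/- For every integer n ≥ 3 and every real x, the Boubaker polynomials satisfy the recurrence B_n(x) = x · B_{n-1}(x) − B_{n-2}(x). -/
/-- The Boubaker polynomials (as real functions), defined by `B 0 x = 1` and, for `n ≥ 1`,
`B n x = ∑_{p=0}^{⌊n/2⌋} (-1)^p ((n-4p)/(n-p)) C(n-p, p) x^(n-2p)`. -/
noncomputable def boubakerFun (n : ℕ) (x : ℝ) : ℝ :=
  if n = 0 then 1
  else ∑ p ∈ Finset.range (n / 2 + 1),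
    (-1 : ℝ) ^ p * (((n : ℝ) - 4 * p) / ((n : ℝ) - p)) * ((n - p).choose p : ℝ) * x ^ (n - 2 * p)

/-- The summand of the Boubaker polynomial. -/
noncomputable def boubakerTerm (n : ℕ) (x : ℝ) (p : ℕ) : ℝ :=
  (-1 : ℝ) ^ p * (((n : ℝ) - 4 * p) / ((n : ℝ) - p)) * ((n - p).choose p : ℝ) * x ^ (n - 2 * p)

theorem boubakerFun_eq (n : ℕ) (hn : 1 ≤ n) (x : ℝ) (N : ℕ) (hN : n / 2 + 1 ≤ N) :
    boubakerFun n x = ∑ p ∈ Finset.range N, boubakerTerm n x p := by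
  unfold boubakerFun
  rw [if_neg (by omega)]
  apply Finset.sum_subset
  · intro p hp
    simp only [Finset.mem_range] at *
    omega
  · intro p _ hp
    simp only [Finset.mem_range] at hp
    rw [Nat.choose_eq_zero_of_lt (by omega)]
    simp

theorem boubakerTerm_rec (m : ℕ) (hm : 1 ≤ m) (x : ℝ) (p : ℕ) :
    boubakerTerm (m + 2) x (p + 1) = x * boubakerTerm (m + 1) x (p + 1) - boubakerTerm m x p := by
  unfold boubakerTerm
  by_cases h : 2 * p ≤ m
  · obtain ⟨k, rfl⟩ : ∃ k, m = k + p := ⟨m - p, by omega⟩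
    have hk : (k : ℝ) ≠ 0 := by
      have : k ≠ 0 := by omega
      exact_mod_cast this
    have hk1 : (k : ℝ) + 1 ≠ 0 := by positivity
    have hp1 : (p : ℝ) + 1 ≠ 0 := by positivity
    have e1 : k + p + 2 - (p + 1) = k + 1 := by omega
    have e2 : k + p + 1 - (p + 1) = k := by omega
    have e3 : k + p - p = k := by omega
    have e4 : k + p + 2 - 2 * (p + 1) = k - p := by omega
    have e5 : k + p - 2 * p = k - p := by omega
    have hpk : p ≤ k := by omega
    have c1 : (k.choose (p + 1) : ℝ) = k.choose p * ((k : ℝ) - p) / (p + 1) := by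
      rw [eq_div_iff hp1]
      have := Nat.choose_succ_right_eq k p
      have h2 : ((k.choose (p + 1) * (p + 1) : ℕ) : ℝ) = ((k.choose p * (k - p) : ℕ) : ℝ) := by
        rw [this]
      rw [Nat.cast_mul, Nat.cast_mul, Nat.cast_sub hpk] at h2
      exact_mod_cast h2
    have c2 : ((k + 1).choose (p + 1) : ℝ) = k.choose p * ((k : ℝ) + 1) / (p + 1) := by
      rw [eq_div_iff hp1]
      have := Nat.add_one_mul_choose_eq k p
      have h2 : (((k + 1) * k.choose p : ℕ) : ℝ) = (((k + 1).choose (p + 1) * (p + 1) : ℕ) : ℝ) := by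
        rw [this]
      push_cast at h2
      linarith
    have hx : x * ((k.choose (p + 1) : ℝ) * x ^ (k + p + 1 - 2 * (p + 1)))
        = (k.choose (p + 1) : ℝ) * x ^ (k - p) := by
      rcases Nat.eq_or_lt_of_le hpk with h' | h'
      · rw [Nat.choose_eq_zero_of_lt (by omega)]; simp
      · have : k - p = (k + p + 1 - 2 * (p + 1)) + 1 := by omega
        rw [this, pow_succ]; ring
    have d1 : ((k + p + 2 : ℕ) : ℝ) - ((p + 1 : ℕ) : ℝ) = k + 1 := by push_cast; ring
    have d2 : ((k + p + 1 : ℕ) : ℝ) - ((p + 1 : ℕ) : ℝ) = k := by push_cast; ring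
    have d3 : ((k + p : ℕ) : ℝ) - (p : ℝ) = k := by push_cast; ring
    rw [d1, d2, d3, e1, e2, e3, e4, e5]
    have hx' : ∀ a : ℝ, x * (a * (k.choose (p + 1) : ℝ) * x ^ (k + p + 1 - 2 * (p + 1)))
        = a * ((k.choose (p + 1) : ℝ) * x ^ (k - p)) := by
      intro a
      rw [← hx]; ring
    rw [hx', c1, c2]
    push_cast
    field_simp
    ring
  · rw [Nat.choose_eq_zero_of_lt (by omega : m + 2 - (p + 1) < p + 1),
      Nat.choose_eq_zero_of_lt (by omega : m + 1 - (p + 1) < p + 1),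
      Nat.choose_eq_zero_of_lt (by omega : m - p < p)]
    simp

/-- For every integer `n ≥ 3` and every real `x`, the Boubaker polynomials satisfy the
recurrence `B n x = x * B (n-1) x - B (n-2) x`. -/
theorem boubaker_recurrence (n : ℕ) (hn : 3 ≤ n) (x : ℝ) :
    boubakerFun n x = x * boubakerFun (n - 1) x - boubakerFun (n - 2) x := by
  obtain ⟨m, rfl⟩ : ∃ m, n = m + 2 := ⟨n - 2, by omega⟩
  have e1 : m + 2 - 1 = m + 1 := by omega
  have e2 : m + 2 - 2 = m := by omega
  rw [e1, e2, boubakerFun_eq (m + 2) (by omega) x (m + 2 + 1) (by omega),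
    boubakerFun_eq (m + 1) (by omega) x (m + 2 + 1) (by omega),
    boubakerFun_eq m (by omega) x (m + 2) (by omega),
    Finset.sum_range_succ' (boubakerTerm (m + 2) x), Finset.sum_range_succ' (boubakerTerm (m + 1) x),
    Finset.sum_congr rfl (fun p _ => boubakerTerm_rec m (by omega) x p),
    Finset.sum_sub_distrib, ← Finset.mul_sum]
  have h0 : boubakerTerm (m + 2) x 0 = x * boubakerTerm (m + 1) x 0 := by
    unfold boubakerTerm
    have h1 : ((m : ℝ) + 2) ≠ 0 := by positivity
    have h2 : ((m : ℝ) + 1) ≠ 0 := by positivity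
    simp [h1, h2]
    ring
  rw [h0]
  ring
end

section
/- Suppose u ∈ C^{N+1}([0,1]) and let u₀ be the best L²([0,1]) approximation of u from S_N = span{B_0, …, B_N} (equivalently, from the space of polynomials of degree at most N), i.e., ‖u − u₀‖_{L²[0,1]} ≤ ‖u − y‖_{L²[0,1]} for all y ∈ S_N. Then ‖u − u₀‖_{L²[0,1]} ≤ (max_{x∈[0,1]} |u^{(N+1)}(x)|) / ((N+1) · √(2N+3)). -/
open Polynomial

/-- The Boubaker polynomials, defined by `B 0 = 1` and, for `n ≥ 1`,
`B n = ∑_{p=0}^{⌊n/2⌋} (-1)^p ((n-4p)/(n-p)) C(n-p, p) X^(n-2p)`. -/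
noncomputable def boubaker (n : ℕ) : Polynomial ℝ :=
  if n = 0 then 1
  else ∑ p ∈ Finset.range (n / 2 + 1),
    Polynomial.C ((-1 : ℝ) ^ p * (((n : ℝ) - 4 * p) / ((n : ℝ) - p)) * ((n - p).choose p : ℝ)) *
      Polynomial.X ^ (n - 2 * p)

/-- Membership in `S_N = span{B₀, …, B_N}`, viewed as a space of real functions. -/
def MemSpanBoubaker (N : ℕ) (f : ℝ → ℝ) : Prop :=
  ∃ p ∈ Submodule.span ℝ (Set.range fun i : Fin (N + 1) => boubaker i),
    ∀ x : ℝ, f x = Polynomial.eval x p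

/-- The `L²([0,1])` norm `‖f‖ = (∫₀¹ f(x)² dx)^{1/2}`. -/
noncomputable def l2Norm (f : ℝ → ℝ) : ℝ :=
  Real.sqrt (∫ x in (0 : ℝ)..1, (f x) ^ 2)


lemma boubaker_natDegree_coeff (n : ℕ) :
    (boubaker n).natDegree ≤ n ∧ (boubaker n).coeff n = 1 := by
  by_cases hn : n = 0
  · subst hn
    simp [boubaker]
  · have hn' : (n : ℝ) ≠ 0 := by exact_mod_cast hn
    constructor
    · rw [boubaker, if_neg hn]
      apply Polynomial.natDegree_sum_le_of_forall_le
      intro p _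
      exact (Polynomial.natDegree_C_mul_X_pow_le _ _).trans (Nat.sub_le _ _)
    · rw [boubaker, if_neg hn, Polynomial.finsetSum_coeff, Finset.sum_eq_single 0]
      · simp [hn']
      · intro p hp hp0
        rw [Polynomial.coeff_C_mul_X_pow, if_neg]
        omega
      · simp

lemma mem_span_boubaker (N n : ℕ) (hn : n ≤ N) (q : Polynomial ℝ) (hq : q.natDegree ≤ n) :
    q ∈ Submodule.span ℝ (Set.range fun i : Fin (N + 1) => boubaker i) := by
  induction n generalizing q with
  | zero =>
    have h := Polynomial.eq_C_of_natDegree_le_zero hq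
    have : q = q.coeff 0 • boubaker 0 := by
      rw [boubaker, if_pos rfl, Polynomial.smul_eq_C_mul, mul_one]
      exact h
    rw [this]
    exact Submodule.smul_mem _ _ (Submodule.subset_span ⟨⟨0, by omega⟩, rfl⟩)
  | succ n ih =>
    obtain ⟨h1, h2⟩ := boubaker_natDegree_coeff (n + 1)
    have hr : (q - q.coeff (n + 1) • boubaker (n + 1)).natDegree ≤ n := by
      rw [Polynomial.natDegree_le_iff_coeff_eq_zero]
      intro m hm
      rcases Nat.eq_or_lt_of_le (Nat.succ_le_of_lt hm) with h | h
      · have : m = n + 1 := by omega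
        subst this
        simp [h2]
      · rw [Polynomial.coeff_sub, Polynomial.coeff_smul,
          Polynomial.coeff_eq_zero_of_natDegree_lt (p := q) (by omega),
          Polynomial.coeff_eq_zero_of_natDegree_lt (p := boubaker (n + 1)) (by omega)]
        simp
    have := ih (by omega) _ hr
    have h3 : q.coeff (n + 1) • boubaker (n + 1) ∈
        Submodule.span ℝ (Set.range fun i : Fin (N + 1) => boubaker i) :=
      Submodule.smul_mem _ _ (Submodule.subset_span ⟨⟨n + 1, by omega⟩, rfl⟩)
    simpa using Submodule.add_mem _ this h3

lemma iterDW_subset_aux {k : ℕ} {u : ℝ → ℝ} {s t : Set ℝ} (st : s ⊆ t)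
    (hs : UniqueDiffOn ℝ s) (ht : UniqueDiffOn ℝ t) (h : ContDiffOn ℝ k u t) {x : ℝ} (hx : x ∈ s) :
    iteratedDerivWithin k u s x = iteratedDerivWithin k u t x := by
  rw [iteratedDerivWithin_eq_iteratedFDerivWithin, iteratedDerivWithin_eq_iteratedFDerivWithin,
    iteratedFDerivWithin_subset st hs ht h hx]

lemma taylor_bound (N : ℕ) (u : ℝ → ℝ)
    (hu : ContDiffOn ℝ (N + 1) u (Set.Icc (0 : ℝ) 1)) (M : ℝ)
    (hM : ∀ x ∈ Set.Icc (0 : ℝ) 1, |iteratedDerivWithin (N + 1) u (Set.Icc (0 : ℝ) 1) x| ≤ M)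
    (x : ℝ) (hx : x ∈ Set.Icc (0 : ℝ) 1) :
    |u x - taylorWithinEval u N (Set.Icc (0 : ℝ) 1) 0 x| ≤ M * x ^ (N + 1) / (N + 1).factorial := by
  have hU : UniqueDiffOn ℝ (Set.Icc (0 : ℝ) 1) := uniqueDiffOn_Icc one_pos
  rcases eq_or_lt_of_le hx.1 with h0 | h0
  · subst h0
    simp
  have hs : Set.uIcc 0 x ⊆ Set.Icc (0 : ℝ) 1 := by
    rw [Set.uIcc_of_le h0.le]
    exact Set.Icc_subset_Icc_right hx.2
  have hUx : UniqueDiffOn ℝ (Set.uIcc 0 x) := uniqueDiffOn_uIcc h0.ne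
  have hd : DifferentiableOn ℝ (iteratedDerivWithin N u (Set.uIcc 0 x)) (Set.uIcc 0 x) :=
    (hu.mono hs).differentiableOn_iteratedDerivWithin (mod_cast N.lt_succ_self) hUx
  obtain ⟨y, hy, h⟩ := taylor_mean_remainder_lagrange h0.ne (hu.mono hs).of_succ
    (hd.mono Set.Ioo_subset_Icc_self)
  have hy' : y ∈ Set.uIcc 0 x := Set.Ioo_subset_Icc_self hy
  have hT : taylorWithinEval u N (Set.uIcc 0 x) 0 x
      = taylorWithinEval u N (Set.Icc (0 : ℝ) 1) 0 x := by
    rw [taylor_within_apply, taylor_within_apply]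
    refine Finset.sum_congr rfl fun k hk => ?_
    rw [iterDW_subset_aux hs hUx hU (hu.of_le _) Set.left_mem_uIcc]
    have := Finset.mem_range.1 hk
    exact_mod_cast this.le
  rw [← hT, h, iterDW_subset_aux hs hUx hU (by exact_mod_cast hu) hy', sub_zero, abs_div,
    abs_mul, abs_of_nonneg (pow_nonneg hx.1 _), Nat.abs_cast]
  have := hM y (hs hy')
  have := pow_nonneg hx.1 (N + 1)
  gcongr

theorem best_approx_error_bound (N : ℕ) (u : ℝ → ℝ)
    (hu : ContDiffOn ℝ (N + 1) u (Set.Icc (0 : ℝ) 1))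
    (u₀ : ℝ → ℝ) (hu₀ : MemSpanBoubaker N u₀)
    (hbest : ∀ y : ℝ → ℝ, MemSpanBoubaker N y →
      l2Norm (fun x => u x - u₀ x) ≤ l2Norm (fun x => u x - y x)) :
    l2Norm (fun x => u x - u₀ x) ≤
      (⨆ x : Set.Icc (0 : ℝ) 1, |iteratedDerivWithin (N + 1) u (Set.Icc (0 : ℝ) 1) x|) /
        ((N + 1) * Real.sqrt (2 * N + 3)) := by
  set M := ⨆ x : Set.Icc (0 : ℝ) 1, |iteratedDerivWithin (N + 1) u (Set.Icc (0 : ℝ) 1) x| with hMdef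
  have hU : UniqueDiffOn ℝ (Set.Icc (0 : ℝ) 1) := uniqueDiffOn_Icc one_pos
  have hc : ContinuousOn (fun x => |iteratedDerivWithin (N + 1) u (Set.Icc (0 : ℝ) 1) x|)
      (Set.Icc (0 : ℝ) 1) :=
    (hu.continuousOn_iteratedDerivWithin (by norm_cast) hU).abs
  have hM : ∀ x ∈ Set.Icc (0 : ℝ) 1,
      |iteratedDerivWithin (N + 1) u (Set.Icc (0 : ℝ) 1) x| ≤ M := by
    intro x hx
    have hb := isCompact_Icc.bddAbove_image hc
    rw [Set.image_eq_range] at hb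
    exact le_ciSup hb ⟨x, hx⟩
  have hM0 : 0 ≤ M := (abs_nonneg _).trans (hM 0 (by simp))
  set T : ℝ → ℝ := fun x => taylorWithinEval u N (Set.Icc (0 : ℝ) 1) 0 x with hT
  have hTmem : MemSpanBoubaker N T := by
    refine ⟨∑ k ∈ Finset.range (N + 1), Polynomial.C ((k.factorial : ℝ)⁻¹ *
      iteratedDerivWithin k u (Set.Icc (0 : ℝ) 1) 0) * Polynomial.X ^ k,
      mem_span_boubaker N N le_rfl _ ?_, fun x => ?_⟩
    · apply Polynomial.natDegree_sum_le_of_forall_le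
      intro k hk
      have := Finset.mem_range.1 hk
      exact (Polynomial.natDegree_C_mul_X_pow_le _ _).trans (by omega)
    · simp only [hT, taylor_within_apply, Polynomial.eval_finsetSum, Polynomial.eval_mul,
        Polynomial.eval_C, Polynomial.eval_pow, Polynomial.eval_X, sub_zero, smul_eq_mul]
      exact Finset.sum_congr rfl fun k _ => by ring
  have hTc : Continuous T := by
    obtain ⟨p, _, hp⟩ := hTmem
    have : T = fun x => p.eval x := funext hp
    rw [this]
    exact p.continuous
  refine (hbest T hTmem).trans ?_
  have hf : (N + 1 : ℝ) ≤ (N + 1).factorial := by exact_mod_cast Nat.self_le_factorial (N + 1)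
  have hN : (0 : ℝ) < N + 1 := by positivity
  unfold l2Norm
  apply Real.sqrt_le_iff.2
  refine ⟨by positivity, ?_⟩
  have hI : IntervalIntegrable (fun x => (u x - T x) ^ 2) MeasureTheory.volume 0 1 := by
    apply ContinuousOn.intervalIntegrable
    rw [Set.uIcc_of_le zero_le_one]
    exact (hu.continuousOn.sub hTc.continuousOn).pow 2
  calc ∫ x in (0 : ℝ)..1, (u x - T x) ^ 2
      ≤ ∫ x in (0 : ℝ)..1, (M / (N + 1)) ^ 2 * x ^ (2 * N + 2) := by
        apply intervalIntegral.integral_mono_on zero_le_one hI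
        · exact (by fun_prop : Continuous fun x : ℝ => (M / (N + 1)) ^ 2 * x ^ (2 * N + 2)).intervalIntegrable _ _
        · intro x hx
          have h1 := taylor_bound N u hu M hM x hx
          have hp := pow_nonneg hx.1 (N + 1)
          have h2 : |u x - T x| ≤ M / (N + 1) * x ^ (N + 1) := by
            refine h1.trans ?_
            rw [div_mul_eq_mul_div]
            gcongr
          calc (u x - T x) ^ 2 = |u x - T x| ^ 2 := (sq_abs _).symm
            _ ≤ (M / (N + 1) * x ^ (N + 1)) ^ 2 := by gcongr
            _ = _ := by ring
    _ = (M / ((N + 1) * Real.sqrt (2 * N + 3))) ^ 2 := by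
        rw [intervalIntegral.integral_const_mul, integral_pow, div_pow, div_pow, mul_pow,
          Real.sq_sqrt (by positivity)]
        push_cast
        simp
        field_simp
        try ring
end
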